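/- For all r, R with 0 < r < R there exists a constant C_{r,R} such that the kernel K(t,z) = ∫_{ℝ³} ψ(ξ) e^{i t ξ₃/|ξ| + i z·ξ} dξ satisfies ‖K(t,·)‖_{L^∞(ℝ³)} ≤ C_{r,R} min{1, t^{−1/2}} for all t > 0. -/

import Mathlib

open MeasureTheory Real Topology Filter Set
open scoped ENNReal NNReal

noncomputable section

/-- Vector in `ℝ³`. -/
abbrev V3 := Fin 3 → ℝ

/-- Euclidean norm on `ℝ³`. -/
def enorm3 (ξ : V3) : ℝ := Real.sqrt (∑ i : Fin 3, ξ i ^ 2)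

/-- The domain `𝓒_{r,R} = {ξ ∈ ℝ³ : |ξ₃| > r and |ξ| ≤ R}`. -/
def coneSet (r R : ℝ) : Set V3 := {ξ | r < |ξ 2| ∧ enorm3 ξ ≤ R}

/-- The oscillatory kernel `K(t,z) = ∫ ψ(ξ) e^{i t ξ₃/|ξ| + i z·ξ} dξ`. -/
def Kker (ψ : V3 → ℝ) (t : ℝ) (z : V3) : ℂ :=
  ∫ ξ : V3, (ψ ξ : ℂ) *
    Complex.exp (Complex.I * ((t * (ξ 2 / enorm3 ξ) + ∑ i : Fin 3, z i * ξ i : ℝ) : ℂ))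

lemma aux_cut {E : Type*} [NormedAddCommGroup E] [NormedSpace ℝ E] (ψ : V3 → ℝ) (h : V3 → E)
    (hψ : ContDiff ℝ 1 ψ) (hs : ∀ ξ ∈ tsupport ψ, ξ 2 ≠ 0)
    (hh : ∀ ξ : V3, ξ 2 ≠ 0 → ContDiffAt ℝ 1 h ξ) : ContDiff ℝ 1 (fun ξ => ψ ξ • h ξ) := by
  rw [contDiff_iff_contDiffAt]
  intro ξ
  by_cases hξ : ξ ∈ tsupport ψ
  · exact hψ.contDiffAt.smul (hh ξ (hs ξ hξ))
  · have h0 : (fun ξ => ψ ξ • h ξ) =ᶠ[𝓝 ξ] fun _ => (0 : E) := by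
      have := notMem_tsupport_iff_eventuallyEq.1 hξ
      filter_upwards [this] with x hx
      simp [hx]
    exact contDiffAt_const.congr_of_eventuallyEq h0

lemma aux_enorm_pos (ξ : V3) (h : ξ 2 ≠ 0) : 0 < ∑ i : Fin 3, ξ i ^ 2 := by
  rw [Fin.sum_univ_three]
  positivity

lemma aux_enorm_cd (ξ : V3) (h : ξ 2 ≠ 0) : ContDiffAt ℝ 1 enorm3 ξ := by
  unfold enorm3
  apply ContDiffAt.sqrt
  · fun_prop
  · exact (aux_enorm_pos ξ h).ne'

def phs (t : ℝ) (z : V3) (ξ : V3) : ℂ :=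
  Complex.exp (Complex.I * ((t * (ξ 2 / enorm3 ξ) + ∑ i : Fin 3, z i * ξ i : ℝ) : ℂ))

lemma aux_phs_norm (t : ℝ) (z ξ : V3) : ‖phs t z ξ‖ = 1 := by
  unfold phs
  rw [mul_comm]
  exact Complex.norm_exp_ofReal_mul_I _

lemma aux_phs_cd (t : ℝ) (z ξ : V3) (h : ξ 2 ≠ 0) : ContDiffAt ℝ 1 (phs t z) ξ := by
  unfold phs
  have h1 := aux_enorm_cd ξ h
  have h2 : enorm3 ξ ≠ 0 := (Real.sqrt_pos.2 (aux_enorm_pos ξ h)).ne'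
  apply ContDiffAt.cexp
  apply ContDiffAt.mul contDiffAt_const
  apply Complex.ofRealCLM.contDiff.contDiffAt.comp
  apply ContDiffAt.add
  · exact contDiffAt_const.mul (ContDiffAt.div (by fun_prop) h1 h2)
  · fun_prop

lemma aux_rot (ψ : V3 → ℝ)
    (hψradial : ∀ ξ ξ' : V3, ξ 2 = ξ' 2 → ξ 0 ^ 2 + ξ 1 ^ 2 = ξ' 0 ^ 2 + ξ' 1 ^ 2 →
      ψ ξ = ψ ξ') (t : ℝ) (z : V3) : ∃ z' : V3, z' 1 = 0 ∧ Kker ψ t z = Kker ψ t z' := by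
  by_cases hρ : z 0 ^ 2 + z 1 ^ 2 = 0
  · exact ⟨z, by nlinarith [sq_nonneg (z 0), sq_nonneg (z 1)], rfl⟩
  set ρ := Real.sqrt (z 0 ^ 2 + z 1 ^ 2) with hρd
  have hpos : 0 < z 0 ^ 2 + z 1 ^ 2 := lt_of_le_of_ne (by positivity) (Ne.symm hρ)
  have hρ2 : ρ ^ 2 = z 0 ^ 2 + z 1 ^ 2 := Real.sq_sqrt hpos.le
  have hρ0 : ρ ≠ 0 := (Real.sqrt_pos.2 hpos).ne'
  obtain ⟨c, hc⟩ : ∃ c, c = z 0 / ρ := ⟨_, rfl⟩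
  obtain ⟨s, hs⟩ : ∃ s, s = z 1 / ρ := ⟨_, rfl⟩
  have hcs : c ^ 2 + s ^ 2 = 1 := by
    rw [hc, hs]; field_simp; exact hρ2.symm
  have hz0 : z 0 = ρ * c := by rw [hc]; field_simp
  have hz1 : z 1 = ρ * s := by rw [hs]; field_simp
  let M : Matrix (Fin 3) (Fin 3) ℝ := !![c, -s, 0; s, c, 0; 0, 0, 1]
  have hdet : M.det = 1 := by
    simp [M, Matrix.det_fin_three]; linarith
  have hmap := Real.map_matrix_volume_pi_eq_smul_volume_pi (M := M) (by rw [hdet]; norm_num)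
  rw [hdet] at hmap
  simp only [inv_one, abs_one, ENNReal.ofReal_one, one_smul] at hmap
  have hemb : MeasurableEmbedding (Matrix.toLin' M) := by
    have hinj : Function.Injective (Matrix.toLin' M) := by
      rw [Matrix.toLin'_apply']
      apply Matrix.mulVec_injective_of_isUnit
      rw [Matrix.isUnit_iff_isUnit_det, hdet]; exact isUnit_one
    exact ((Matrix.toLin' M).continuous_of_finiteDimensional).measurableEmbedding hinj
  refine ⟨![ρ, 0, z 2], rfl, ?_⟩
  unfold Kker
  conv_lhs => rw [← hmap]
  rw [hemb.integral_map]
  congr 1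
  ext ξ
  have e0 : Matrix.toLin' M ξ 0 = c * ξ 0 - s * ξ 1 := by
    simp [M, Matrix.toLin'_apply, Matrix.mulVec, dotProduct, Fin.sum_univ_three]; ring
  have e1 : Matrix.toLin' M ξ 1 = s * ξ 0 + c * ξ 1 := by
    simp [M, Matrix.toLin'_apply, Matrix.mulVec, dotProduct, Fin.sum_univ_three]
  have e2 : Matrix.toLin' M ξ 2 = ξ 2 := by
    simp [M, Matrix.toLin'_apply, Matrix.mulVec, dotProduct, Fin.sum_univ_three]
  have hq : (Matrix.toLin' M ξ 0) ^ 2 + (Matrix.toLin' M ξ 1) ^ 2 = ξ 0 ^ 2 + ξ 1 ^ 2 := by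
    rw [e0, e1]
    linear_combination (ξ 0 ^ 2 + ξ 1 ^ 2) * hcs
  have hn : enorm3 (Matrix.toLin' M ξ) = enorm3 ξ := by
    unfold enorm3
    rw [Fin.sum_univ_three, Fin.sum_univ_three, hq, e2]
  rw [hψradial _ ξ e2 hq, hn, e2]
  congr 4
  rw [Fin.sum_univ_three, Fin.sum_univ_three, e0, e1, e2, hz0, hz1]
  simp
  linear_combination (ρ * ξ 0) * hcs

lemma aux_int (t : ℝ) (ht : 0 < t) : Integrable (fun y : ℝ => (1 + t * y ^ 2)⁻¹) ∧
    ∫ y : ℝ, (1 + t * y ^ 2)⁻¹ = π * (Real.sqrt t)⁻¹ := by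
  have hs : 0 < Real.sqrt t := Real.sqrt_pos.2 ht
  have e : (fun y : ℝ => (1 + t * y ^ 2)⁻¹) = fun y => (1 + (Real.sqrt t * y) ^ 2)⁻¹ := by
    ext y; rw [mul_pow, Real.sq_sqrt ht.le]
  rw [e]
  refine ⟨integrable_inv_one_add_sq.comp_mul_left' hs.ne', ?_⟩
  rw [Measure.integral_comp_mul_left (fun y : ℝ => (1 + y ^ 2)⁻¹), integral_univ_inv_one_add_sq,
    abs_of_pos (inv_pos.2 hs), smul_eq_mul, mul_comm]

lemma aux_maj (B t : ℝ) (hB : 0 < B) (ht : 0 < t) (g : V3 → ℝ)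
    (hg : g = fun ξ => (Icc (-B) B).indicator 1 (ξ 0) *
      (2 * (1 + t * ξ 1 ^ 2)⁻¹ + (Real.sqrt t)⁻¹ * (Icc (-B) B).indicator 1 (ξ 1)) *
      (Icc (-B) B).indicator 1 (ξ 2)) :
    Integrable g ∧ ∫ ξ, g ξ = (2 * B) ^ 2 * (2 * π + 2 * B) * (Real.sqrt t)⁻¹ := by
  have hI : Integrable ((Icc (-B) B).indicator (1 : ℝ → ℝ)) := by
    rw [integrable_indicator_iff measurableSet_Icc]
    exact continuousOn_const.integrableOn_compact isCompact_Icc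
  have hIv : ∫ y, (Icc (-B) B).indicator (1 : ℝ → ℝ) y = 2 * B := by
    rw [integral_indicator_one measurableSet_Icc]
    simp [measureReal_def]
    rw [ENNReal.toReal_ofReal (by linarith)]; ring
  obtain ⟨h1, h2⟩ := aux_int t ht
  let f : Fin 3 → ℝ → ℝ := ![(Icc (-B) B).indicator 1,
    fun y => 2 * (1 + t * y ^ 2)⁻¹ + (Real.sqrt t)⁻¹ * (Icc (-B) B).indicator 1 y,
    (Icc (-B) B).indicator 1]
  have hgf : g = fun ξ => ∏ i, f i (ξ i) := by
    rw [hg]; ext ξ; rw [Fin.prod_univ_three]; rfl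
  have hm : Integrable (f 1) := (h1.const_mul 2).add (hI.const_mul _)
  have hf : ∀ i, Integrable (f i) := by
    intro i; fin_cases i
    · exact hI
    · exact hm
    · exact hI
  rw [hgf]
  refine ⟨Integrable.fintype_prod hf, ?_⟩
  rw [integral_fintype_prod_volume_eq_prod, Fin.prod_univ_three]
  have a0 : ∫ y, f 0 y = 2 * B := hIv
  have a2 : ∫ y, f 2 y = 2 * B := hIv
  have a1 : ∫ y, f 1 y = 2 * (π * (Real.sqrt t)⁻¹) + (Real.sqrt t)⁻¹ * (2 * B) := by
    change ∫ y, (2 * (1 + t * y ^ 2)⁻¹ + (Real.sqrt t)⁻¹ * (Icc (-B) B).indicator 1 y) = _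
    rw [integral_add (h1.const_mul 2) (hI.const_mul _), integral_const_mul, integral_const_mul,
      h2, hIv]
  rw [a0, a1, a2]; ring

lemma aux_ibp (F : V3 → ℂ) (hF : ContDiff ℝ 1 F) (hc : HasCompactSupport F) (v : V3) :
    Integrable (fun ξ => fderiv ℝ F ξ v) ∧ ∫ ξ, fderiv ℝ F ξ v = 0 := by
  have h1 : Integrable (fun ξ => fderiv ℝ F ξ v) :=
    ((hF.continuous_fderiv one_ne_zero).clm_apply continuous_const).integrable_of_hasCompactSupport
      (hc.fderiv_apply (𝕜 := ℝ) v)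
  refine ⟨h1, ?_⟩
  have := integral_mul_fderiv_eq_neg_fderiv_mul_of_integrable (μ := (volume : Measure V3))
    (f := fun _ => (1 : ℂ)) (g := F) (v := v) (by simp) (by simpa using h1)
    (by simpa using hF.continuous.integrable_of_hasCompactSupport hc)
    (fun x _ => by fun_prop) (fun x _ => hF.differentiable one_ne_zero x)
  simpa using this

lemma aux_curve (ξ : V3) : HasDerivAt (fun s : ℝ => ξ + s • (Pi.single 1 1 : V3)) (Pi.single 1 1) 0 := by
  simpa using ((hasDerivAt_id (0 : ℝ)).smul_const (Pi.single 1 1 : V3)).const_add ξ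

lemma aux_deriv_phs (t : ℝ) (z ξ : V3) (hz : z 1 = 0) (h : ξ 2 ≠ 0) :
    HasDerivAt (fun s : ℝ => phs t z (ξ + s • (Pi.single 1 1 : V3)))
      (phs t z ξ * (Complex.I * ((t * (-(ξ 1 * (ξ 2 / enorm3 ξ ^ 3))) : ℝ) : ℂ))) 0 := by
  have hpos := aux_enorm_pos ξ h
  have hn : enorm3 ξ ≠ 0 := (Real.sqrt_pos.2 hpos).ne'
  have h1 : HasDerivAt (fun s : ℝ => enorm3 (ξ + s • (Pi.single 1 1 : V3))) (ξ 1 / enorm3 ξ) 0 := by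
    have e : (fun s : ℝ => enorm3 (ξ + s • (Pi.single 1 1 : V3))) =
        fun s => Real.sqrt (ξ 0 ^ 2 + (ξ 1 + s) ^ 2 + ξ 2 ^ 2) := by
      ext s; unfold enorm3; rw [Fin.sum_univ_three]; simp
    rw [e]
    have := ((((hasDerivAt_id (0:ℝ)).const_add (ξ 1)).pow 2).const_add (ξ 0 ^ 2)).add_const (ξ 2 ^ 2)
    have h3 := this.sqrt (by rw [Fin.sum_univ_three] at hpos; simpa using hpos.ne')
    refine h3.congr_deriv ?_
    unfold enorm3 at hn ⊢
    rw [Fin.sum_univ_three] at hn ⊢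
    simp
    field_simp
  have h2 : HasDerivAt (fun s : ℝ => t * ((ξ + s • (Pi.single 1 1 : V3)) 2 /
      enorm3 (ξ + s • (Pi.single 1 1 : V3))) + ∑ i : Fin 3, z i * (ξ + s • (Pi.single 1 1 : V3)) i)
      (t * (-(ξ 1 * (ξ 2 / enorm3 ξ ^ 3)))) 0 := by
    have e : (fun s : ℝ => t * ((ξ + s • (Pi.single 1 1 : V3)) 2 /
      enorm3 (ξ + s • (Pi.single 1 1 : V3))) + ∑ i : Fin 3, z i * (ξ + s • (Pi.single 1 1 : V3)) i)
      = fun s : ℝ => t * (ξ 2 /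
      enorm3 (ξ + s • (Pi.single 1 1 : V3))) + (z 0 * ξ 0 + z 2 * ξ 2) := by
      ext s; rw [Fin.sum_univ_three]; simp [hz]
    rw [e]
    have := (((hasDerivAt_const (0:ℝ) (ξ 2)).div h1 (by simpa using hn)).const_mul t).add_const
      (z 0 * ξ 0 + z 2 * ξ 2)
    refine this.congr_deriv ?_
    simp
    field_simp
  have h3 := ((h2.ofReal_comp).const_mul Complex.I).cexp
  unfold phs
  simpa using h3

lemma aux_main (ψ : V3 → ℝ) (hψ : ContDiff ℝ 1 ψ) (hc : HasCompactSupport ψ) (B : ℝ) (hB : 0 < B)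
    (hs : ∀ ξ ∈ tsupport ψ, ξ 2 ≠ 0) (hb : ∀ ξ ∈ tsupport ψ, ∀ i, ξ i ∈ Icc (-B) B) :
    ∃ C > (0:ℝ), ∀ t : ℝ, 0 < t → ∀ z : V3, z 1 = 0 →
      ‖Kker ψ t z‖ ≤ C * (Real.sqrt t)⁻¹ := by
  obtain ⟨G, hG⟩ : ∃ G : V3 → ℝ, G = fun ξ => ψ ξ • (enorm3 ξ ^ 3 / ξ 2) := ⟨_, rfl⟩
  have hGcd : ContDiff ℝ 1 G := by
    rw [hG]
    refine aux_cut ψ _ hψ hs fun ξ h => ?_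
    exact ((aux_enorm_cd ξ h).pow 3).div (by fun_prop) h
  have hGc : HasCompactSupport G := by rw [hG]; exact hc.smul_right
  have hGs : tsupport G ⊆ tsupport ψ := by
    rw [hG]; exact tsupport_smul_subset_left ψ _
  obtain ⟨v, hv⟩ : ∃ v : V3, v = Pi.single 1 1 := ⟨_, rfl⟩
  obtain ⟨M1, hM1⟩ := hψ.continuous.bounded_above_of_compact_support hc
  obtain ⟨M2, hM2⟩ := hGcd.continuous.bounded_above_of_compact_support hGc
  obtain ⟨M3, hM3⟩ := ((hGcd.continuous_fderiv one_ne_zero).clm_apply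
    (continuous_const (y := v))).bounded_above_of_compact_support (hGc.fderiv_apply (𝕜 := ℝ) v)
  have hM10 : 0 ≤ M1 := (norm_nonneg _).trans (hM1 0)
  have hM20 : 0 ≤ M2 := (norm_nonneg _).trans (hM2 0)
  have hM30 : 0 ≤ M3 := (norm_nonneg _).trans (hM3 0)
  obtain ⟨M, hM⟩ : ∃ M, M = M1 + M2 + M3 + 1 := ⟨_, rfl⟩
  have hM0 : 0 < M := by linarith
  refine ⟨M * ((2 * B) ^ 2 * (2 * π + 2 * B)), by positivity, fun t ht z hz => ?_⟩
  have hst : 0 < Real.sqrt t := Real.sqrt_pos.2 ht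
  obtain ⟨hgi, hgv⟩ := aux_maj B t hB ht _ rfl
  obtain ⟨w, hw⟩ : ∃ w : V3 → ℝ, w = fun ξ => ξ 1 * (1 + t * ξ 1 ^ 2)⁻¹ := ⟨_, rfl⟩
  have hD : ∀ y : ℝ, 0 < 1 + t * y ^ 2 := fun y => by positivity
  have hwcd : ContDiff ℝ 1 w := by
    rw [hw]
    exact ContDiff.mul (by fun_prop) (ContDiff.inv (by fun_prop) fun ξ => (hD _).ne')
  obtain ⟨F, hF⟩ : ∃ F : V3 → ℂ, F = fun ξ => G ξ • (Complex.I * (w ξ : ℂ) * phs t z ξ) := ⟨_, rfl⟩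
  have hFcd : ContDiff ℝ 1 F := by
    rw [hF]
    refine aux_cut G _ hGcd (fun ξ h => hs ξ (hGs h)) fun ξ h => ?_
    exact (contDiffAt_const.mul (Complex.ofRealCLM.contDiff.contDiffAt.comp ξ hwcd.contDiffAt)).mul
      (aux_phs_cd t z ξ h)
  have hFc : HasCompactSupport F := by rw [hF]; exact hGc.smul_right
  obtain ⟨hFi, hF0⟩ := aux_ibp F hFcd hFc v
  have hKi : Integrable (fun ξ => (ψ ξ : ℂ) * phs t z ξ) := by
    have := aux_cut ψ (phs t z) hψ hs (aux_phs_cd t z)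
    have h2 := this.continuous.integrable_of_hasCompactSupport (μ := volume) (hc.smul_right)
    simpa using h2
  have hK : Kker ψ t z = ∫ ξ, ((ψ ξ : ℂ) * phs t z ξ - fderiv ℝ F ξ v) := by
    rw [integral_sub hKi hFi, hF0, sub_zero]; rfl
  rw [hK, mul_assoc, ← hgv, ← integral_const_mul]
  refine norm_integral_le_of_norm_le (hgi.const_mul M) (Eventually.of_forall fun ξ => ?_)
  by_cases hξ : ξ ∈ tsupport ψ
  swap
  · have h1 : ψ ξ = 0 := image_eq_zero_of_notMem_tsupport hξ
    have h2 : fderiv ℝ F ξ = 0 := by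
      have h3 : ξ ∉ tsupport F := fun h => hξ (hGs (by
        rw [hF] at h; exact tsupport_smul_subset_left G _ h))
      exact image_eq_zero_of_notMem_tsupport fun h => h3 (tsupport_fderiv_subset ℝ h)
    simp only [h1, h2]
    simp only [Complex.ofReal_zero, zero_mul, zero_apply, sub_zero, norm_zero]
    have hi : ∀ y : ℝ, 0 ≤ (Icc (-B) B).indicator (1 : ℝ → ℝ) y :=
      fun y => indicator_nonneg (fun _ _ => zero_le_one) y
    have := hD (ξ 1)
    have := hi (ξ 0)
    have := hi (ξ 1)
    have := hi (ξ 2)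
    positivity
  have hξ2 := hs ξ hξ
  have hn : enorm3 ξ ≠ 0 := (Real.sqrt_pos.2 (aux_enorm_pos ξ hξ2)).ne'
  have hD1 := hD (ξ 1)
  obtain ⟨D, hDd⟩ : ∃ D, D = 1 + t * ξ 1 ^ 2 := ⟨_, rfl⟩
  obtain ⟨w', hw'⟩ : ∃ w', w' = (1 - t * ξ 1 ^ 2) / D ^ 2 := ⟨_, rfl⟩
  have dw : HasDerivAt (fun s : ℝ => w (ξ + s • v)) w' 0 := by
    have e : (fun s : ℝ => w (ξ + s • v)) = fun s => (ξ 1 + s) * (1 + t * (ξ 1 + s) ^ 2)⁻¹ := by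
      ext s; rw [hw, hv]; simp
    rw [e]
    have h1 := (hasDerivAt_id (0:ℝ)).const_add (ξ 1)
    have := h1.mul ((((h1.pow 2).const_mul t).const_add 1).inv (by simpa using hD1.ne'))
    refine this.congr_deriv ?_
    rw [hw', hDd]
    simp
    field_simp
    ring
  have dG : HasDerivAt (fun s : ℝ => G (ξ + s • v)) (fderiv ℝ G ξ v) 0 := by
    have h1 : HasFDerivAt G (fderiv ℝ G ξ) (ξ + (0:ℝ) • v) := by
      simpa using (hGcd.differentiable one_ne_zero ξ).hasFDerivAt
    rw [hv] at h1 ⊢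
    exact h1.comp_hasDerivAt (0:ℝ) (aux_curve ξ)
  have dF : HasDerivAt (fun s : ℝ => F (ξ + s • v)) (fderiv ℝ F ξ v) 0 := by
    have h1 : HasFDerivAt F (fderiv ℝ F ξ) (ξ + (0:ℝ) • v) := by
      simpa using (hFcd.differentiable one_ne_zero ξ).hasFDerivAt
    rw [hv] at h1 ⊢
    exact h1.comp_hasDerivAt (0:ℝ) (aux_curve ξ)
  have dP := aux_deriv_phs t z ξ hz hξ2
  rw [← hv] at dP
  have dF2 := dG.ofReal_comp.mul ((dw.ofReal_comp.const_mul Complex.I).mul dP)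
  have hfun : (fun s : ℝ => F (ξ + s • v)) = (fun y : ℝ => ((G (ξ + y • v) : ℝ) : ℂ)) *
      ((fun y : ℝ => Complex.I * ((w (ξ + y • v) : ℝ) : ℂ)) * fun s : ℝ => phs t z (ξ + s • v)) := by
    ext s
    simp [hF]
  rw [hfun] at dF
  have hEq := dF.unique dF2
  simp only [Pi.mul_apply] at hEq
  have hGq : ψ ξ = G ξ * (ξ 2 / enorm3 ξ ^ 3) := by
    rw [hG]; simp only [smul_eq_mul]; field_simp
  have hwx : w ξ = ξ 1 / D := by rw [hw, hDd]; rfl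
  have hψD : ψ ξ * (1 - t * ξ 1 * w ξ) = ψ ξ / D := by
    rw [hwx, hDd]; field_simp; ring
  have key : (ψ ξ : ℂ) * phs t z ξ - fderiv ℝ F ξ v =
      (((ψ ξ / D : ℝ) : ℂ) - Complex.I * ((fderiv ℝ G ξ v * w ξ : ℝ) : ℂ)
        - Complex.I * ((G ξ * w' : ℝ) : ℂ)) * phs t z ξ := by
    rw [hEq, ← hψD]
    simp only [zero_smul, add_zero]
    rw [hGq]
    push_cast
    linear_combination ((G ξ : ℂ) * w ξ * phs t z ξ * t * ξ 1 * (ξ 2 / enorm3 ξ ^ 3)) * Complex.I_sq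
  rw [key, norm_mul, aux_phs_norm, mul_one]
  have hDpos : 0 < D := hDd ▸ hD1
  have b1 : ‖((ψ ξ / D : ℝ) : ℂ)‖ ≤ M1 * D⁻¹ := by
    rw [Complex.norm_real, norm_div, Real.norm_of_nonneg hDpos.le, div_eq_mul_inv]
    exact mul_le_mul_of_nonneg_right (hM1 ξ) (by positivity)
  have hwb : ‖w ξ‖ ≤ (Real.sqrt t)⁻¹ := by
    rw [hwx, norm_div, Real.norm_of_nonneg hDpos.le, div_le_iff₀ hDpos, hDd, Real.norm_eq_abs]
    rw [inv_mul_eq_div, le_div_iff₀ hst]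
    have h1 : t * ξ 1 ^ 2 = (|ξ 1| * Real.sqrt t) ^ 2 := by
      rw [mul_pow, sq_abs, Real.sq_sqrt ht.le, mul_comm]
    rw [h1]
    nlinarith [sq_nonneg (|ξ 1| * Real.sqrt t - 1)]
  have b2 : ‖Complex.I * ((fderiv ℝ G ξ v * w ξ : ℝ) : ℂ)‖ ≤ M3 * (Real.sqrt t)⁻¹ := by
    rw [norm_mul, Complex.norm_I, one_mul, Complex.norm_real, norm_mul]
    exact mul_le_mul (hM3 ξ) hwb (norm_nonneg _) hM30
  have hw'b : ‖w'‖ ≤ D⁻¹ := by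
    rw [hw', norm_div, norm_pow, Real.norm_of_nonneg hDpos.le, div_le_iff₀ (by positivity)]
    have : D⁻¹ * D ^ 2 = D := by field_simp
    have h0 : 0 ≤ t * ξ 1 ^ 2 := by positivity
    rw [this, hDd, Real.norm_eq_abs, abs_le]
    constructor <;> linarith
  have b3 : ‖Complex.I * ((G ξ * w' : ℝ) : ℂ)‖ ≤ M2 * D⁻¹ := by
    rw [norm_mul, Complex.norm_I, one_mul, Complex.norm_real, norm_mul]
    exact mul_le_mul (hM2 ξ) hw'b (norm_nonneg _) hM20
  have hi : ∀ i, (Icc (-B) B).indicator (1 : ℝ → ℝ) (ξ i) = 1 :=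
    fun i => by rw [indicator_of_mem (hb ξ hξ i)]; rfl
  simp only [hi]
  rw [← hDd]
  refine (norm_sub_le _ _).trans ((add_le_add (norm_sub_le _ _) le_rfl).trans ?_)
  have hDi : 0 < D⁻¹ := inv_pos.2 hDpos
  have hti : 0 < (Real.sqrt t)⁻¹ := inv_pos.2 hst
  have c1 : M1 * D⁻¹ ≤ M * D⁻¹ := mul_le_mul_of_nonneg_right (by linarith) hDi.le
  have c2 : M2 * D⁻¹ ≤ M * D⁻¹ := mul_le_mul_of_nonneg_right (by linarith) hDi.le
  have c3 : M3 * (Real.sqrt t)⁻¹ ≤ M * (Real.sqrt t)⁻¹ :=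
    mul_le_mul_of_nonneg_right (by linarith) hti.le
  linarith

/-- Lemma 6 of the paper. For all `0 < r < R` there is a constant
`C_{r,R}` such that, for any smooth compactly supported cut-off `ψ`, radial with respect to
the horizontal variables, supported near `𝓒_{r,R}` and equal to `1` on a neighborhood of
`𝓒_{r,R}`, the kernel `K(t,z) = ∫ ψ(ξ) e^{itξ₃/|ξ| + iz·ξ} dξ` satisfies
`‖K(t,·)‖_{L^∞(ℝ³)} ≤ C_{r,R} min{1, t^{-1/2}}` for all `t > 0`. -/
theorem kernel_dispersive_estimate (r R : ℝ) (hr : 0 < r) (hrR : r < R)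
    (ψ : V3 → ℝ) (hψsmooth : ContDiff ℝ (⊤ : ℕ∞) ψ) (hψcpt : HasCompactSupport ψ)
    -- `ψ` is radial with respect to the horizontal variables `ξ_h = (ξ₁, ξ₂)`
    (hψradial : ∀ ξ ξ' : V3, ξ 2 = ξ' 2 → ξ 0 ^ 2 + ξ 1 ^ 2 = ξ' 0 ^ 2 + ξ' 1 ^ 2 →
      ψ ξ = ψ ξ')
    -- `ψ = 1` on a neighborhood of `𝓒_{r,R}`
    (hψone : ∃ U : Set V3, IsOpen U ∧ coneSet r R ⊆ U ∧ Set.EqOn ψ 1 U)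
    -- `ψ` is supported near `𝓒_{r,R}`
    (hψsupp : tsupport ψ ⊆ coneSet (r / 2) (2 * R)) :
    ∃ C > (0:ℝ), ∀ t : ℝ, 0 < t → ∀ z : V3,
      ‖Kker ψ t z‖ ≤ C * min 1 ((Real.sqrt t)⁻¹) := by
  have hmem : ∀ ξ ∈ tsupport ψ, ξ 2 ≠ 0 := by
    intro ξ hξ h0
    have := (hψsupp hξ).1
    rw [h0, abs_zero] at this
    linarith
  have hbox : ∀ ξ ∈ tsupport ψ, ∀ i, ξ i ∈ Icc (-(2 * R)) (2 * R) := by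
    intro ξ hξ i
    have h1 : enorm3 ξ ≤ 2 * R := (hψsupp hξ).2
    refine abs_le.1 (le_trans ?_ h1)
    unfold enorm3
    rw [← Real.sqrt_sq_eq_abs]
    exact Real.sqrt_le_sqrt
      (Finset.single_le_sum (f := fun i => ξ i ^ 2) (fun j _ => sq_nonneg _) (Finset.mem_univ i))
  obtain ⟨C, hC, hCb⟩ := aux_main ψ (hψsmooth.of_le (by exact_mod_cast le_top)) hψcpt (2 * R) (by linarith) hmem hbox
  have hI0 : 0 ≤ ∫ ξ, ‖ψ ξ‖ := integral_nonneg fun _ => norm_nonneg _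
  refine ⟨C + ∫ ξ, ‖ψ ξ‖, by linarith, fun t ht z => ?_⟩
  have hst : 0 < (Real.sqrt t)⁻¹ := inv_pos.2 (Real.sqrt_pos.2 ht)
  rw [mul_min_of_nonneg _ _ (by linarith)]
  refine le_min ?_ ?_
  · have h1 : ‖Kker ψ t z‖ ≤ ∫ ξ, ‖ψ ξ‖ := by
      refine norm_integral_le_of_norm_le
        ((hψsmooth.continuous.integrable_of_hasCompactSupport hψcpt).norm)
        (Eventually.of_forall fun ξ => ?_)
      change ‖(ψ ξ : ℂ) * phs t z ξ‖ ≤ _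
      rw [norm_mul, aux_phs_norm, mul_one, Complex.norm_real]
    linarith
  · obtain ⟨z', hz', he⟩ := aux_rot ψ hψradial t z
    rw [he]
    refine (hCb t ht z' hz').trans ?_
    exact mul_le_mul_of_nonneg_right (by linarith) hst.le

end
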